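/- Let p be a real polynomial of degree d > 1 whose Julia set J(p) is real, and let ξ be a fixed point of p with min J(p) < ξ < max J(p). Then |p'(ξ)| ≥ d. -/

import Mathlib

/-- The filled Julia set of a polynomial: points with bounded forward orbit. -/
def filledJuliaSet (p : Polynomial ℂ) : Set ℂ :=
  {z | Bornology.IsBounded (Set.range fun n => (fun w => p.eval w)^[n] z)}

/-- The Julia set of a polynomial, as the boundary of the filled Julia set. -/
def juliaSet (p : Polynomial ℂ) : Set ℂ := frontier (filledJuliaSet p)

section Helpers
open Polynomial

theorem ellipse_bound (κ : ℂ) (hκ : κ ≠ 0) (T : ℝ) (hT : 0 < T) (h : ‖κ‖ ≤ Real.exp (-T)) (w : ℂ)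
    (hw : w = (κ + κ⁻¹) / 2) :
    Real.sinh T ^ 2 * Real.cosh T ^ 2 ≤ w.re ^ 2 * Real.sinh T ^ 2 + w.im ^ 2 * Real.cosh T ^ 2 := by
  obtain ⟨u, hu⟩ : ∃ u : ℝ, ‖κ‖ = Real.exp (-u) := ⟨-Real.log ‖κ‖, by
    rw [neg_neg, Real.exp_log (norm_pos_iff.2 hκ)]⟩
  have huT : T ≤ u := by rw [hu, Real.exp_le_exp] at h; linarith
  set φ := κ.arg
  have hk : κ = Complex.exp (-u + φ * Complex.I) := by
    rw [Complex.exp_add, ← Complex.ofReal_neg, ← Complex.ofReal_exp, ← hu]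
    exact (Complex.norm_mul_exp_arg_mul_I κ).symm
  have hki : κ⁻¹ = Complex.exp ((u:ℂ) + (-φ : ℝ) * Complex.I) := by
    rw [hk, ← Complex.exp_neg]; congr 1; push_cast; ring
  have hw2 : w = ((Real.cosh u * Real.cos φ : ℝ) : ℂ) + ((- Real.sinh u * Real.sin φ : ℝ) : ℂ) * Complex.I := by
    rw [hw, hki, hk]
    rw [Complex.exp_add, Complex.exp_add, Complex.exp_mul_I, Complex.exp_mul_I]
    rw [Real.cosh_eq, Real.sinh_eq]
    push_cast
    rw [Complex.cos_neg, Complex.sin_neg]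
    ring
  have hre : w.re = Real.cosh u * Real.cos φ := by rw [hw2, Complex.add_re, Complex.re_ofReal_mul, Complex.ofReal_re]; simp
  have him : w.im = - Real.sinh u * Real.sin φ := by rw [hw2, Complex.add_im, Complex.im_ofReal_mul, Complex.ofReal_im]; simp
  rw [hre, him]
  have hs0 : 0 < Real.sinh T := Real.sinh_pos_iff.2 hT
  have hs : Real.sinh T ≤ Real.sinh u := Real.sinh_le_sinh.2 huT
  have hc2 : Real.cosh T ^ 2 ≤ Real.cosh u ^ 2 := by
    rw [Real.cosh_sq, Real.cosh_sq]; gcongr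
  have hs2 : Real.sinh T ^ 2 ≤ Real.sinh u ^ 2 := by gcongr
  have e : Real.sinh T ^ 2 * Real.cosh T ^ 2 = Real.cosh T ^ 2 * Real.cos φ ^ 2 * Real.sinh T ^ 2 + Real.sinh T ^ 2 * Real.sin φ ^ 2 * Real.cosh T ^ 2 := by
    linear_combination (-Real.sinh T ^ 2 * Real.cosh T ^ 2) * Real.sin_sq_add_cos_sq φ
  rw [e, mul_pow, mul_pow, neg_sq]
  gcongr

theorem key_bound (q : Polynomial ℂ) (d : ℕ) (hd : 1 ≤ d) (hdeg : q.natDegree = d)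
    (hq : ∀ z : ℂ, ∀ t : ℝ, |t| ≤ 1 → q.eval z = t → ∃ x : ℝ, |x| ≤ 1 ∧ z = x)
    (s : ℂ) (hs0 : s ≠ 0) (hs1 : ‖s‖ < 1) :
    ∃ κ : ℂ, κ ≠ 0 ∧ ‖κ‖ ≤ ‖s‖ ^ d ∧ q.eval ((s + s⁻¹) / 2) = (κ + κ⁻¹) / 2 := by
  have hJs : ∀ s : ℂ, s ≠ 0 → ‖s‖ < 1 → ∀ x : ℝ, |x| ≤ 1 → (s + s⁻¹) / 2 ≠ x := by
    intro s hs0 hs1 x hx h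
    have h2 : s * s + 1 = 2 * x * s := by
      field_simp at h
      linear_combination h
    have hre := congrArg Complex.re h2
    have him := congrArg Complex.im h2
    simp at hre him
    have hn : s.re * s.re + s.im * s.im < 1 := by
      have := Complex.normSq_eq_norm_sq s
      rw [Complex.normSq_apply] at this
      rw [this]
      have := norm_nonneg s
      nlinarith
    have hx2 : x ^ 2 ≤ 1 := (sq_le_one_iff_abs_le_one x).2 hx
    have h3 : s.im * (s.re - x) = 0 := by linarith
    rcases mul_eq_zero.1 h3 with h4 | h4
    · rw [h4] at hre hn
      nlinarith [sq_nonneg (s.re - x)]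
    · have h5 : x = s.re := by linarith
      subst h5
      nlinarith
  set T : ℂ → ℂ := fun s => ∑ i ∈ Finset.range (d + 1), q.coeff i * s ^ (d - i) * ((s ^ 2 + 1) / 2) ^ i with hT
  have hTe : ∀ s : ℂ, s ≠ 0 → T s = s ^ d * q.eval ((s + s⁻¹) / 2) := by
    intro s hs
    rw [Polynomial.eval_eq_sum_range, hdeg, Finset.mul_sum]
    refine Finset.sum_congr rfl fun i hi => ?_
    have hi' : i ≤ d := by simpa [Nat.lt_succ_iff] using hi
    have e1 : s ^ d = s ^ (d - i) * s ^ i := by rw [← pow_add]; congr 1; omega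
    have e2 : (s ^ 2 + 1) / 2 = s * ((s + s⁻¹) / 2) := by field_simp
    rw [e1, e2, mul_pow]; ring
  have hT0 : T 0 ≠ 0 := by
    have : T 0 = q.coeff d * (1 / 2) ^ d := by
      simp only [hT]
      rw [Finset.sum_eq_single d]
      · simp
      · intro i hi hne
        have hi' : i < d + 1 := by simpa using hi
        rw [zero_pow (by omega)]; simp
      · simp
    rw [this]
    have hc : q.coeff d ≠ 0 := by
      rw [← hdeg]
      have : q ≠ 0 := by rintro rfl; simp at hdeg; omega
      simpa using this
    exact mul_ne_zero hc (pow_ne_zero _ (by norm_num))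
  have hTd : Differentiable ℂ T := by
    simp only [hT]; fun_prop
  have hTne : ∀ s : ℂ, ‖s‖ < 1 → T s ≠ 0 := by
    intro s hs
    by_cases h0 : s = 0
    · rw [h0]; exact hT0
    · rw [hTe s h0]
      refine mul_ne_zero (pow_ne_zero _ h0) fun h => ?_
      obtain ⟨x, hx, hx'⟩ := hq _ 0 (by simp) (by simpa using h)
      exact hJs s h0 hs x hx hx'
  set v : ℂ → ℂ := fun s => s ^ d / T s with hv
  have hslit : ∀ s : ℂ, ‖s‖ < 1 → 1 - v s ^ 2 ∈ Complex.slitPlane := by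
    intro s hs
    by_cases h0 : s = 0
    · simp [hv, h0, show d ≠ 0 by omega]
    · by_contra hcon
      have hw : v s = (q.eval ((s + s⁻¹) / 2))⁻¹ := by
        simp only [hv]; rw [hTe s h0]
        have := pow_ne_zero d h0
        field_simp
      set w := q.eval ((s + s⁻¹) / 2) with hwdef
      have hw0 : w ≠ 0 := by
        intro h; exact hTne s hs (by rw [hTe s h0, ← hwdef, h, mul_zero])
      rw [Complex.mem_slitPlane_iff_not_le_zero, not_not, Complex.le_def] at hcon
      obtain ⟨h1, h2⟩ := hcon
      -- v^2 real ≥ 1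
      have hre : 1 ≤ (v s).re * (v s).re - (v s).im * (v s).im := by
        simp [pow_two] at h1; linarith
      have him : (v s).re * (v s).im = 0 := by
        simp [pow_two] at h2; linarith
      have hvi : (v s).im = 0 := by
        rcases mul_eq_zero.1 him with h | h
        · rw [h] at hre; nlinarith [mul_self_nonneg (v s).im]
        · exact h
      rw [hvi] at hre
      have hvr : v s = ((v s).re : ℂ) := by
        apply Complex.ext <;> simp [hvi]
      have hvabs : 1 ≤ |(v s).re| := by
        rw [← one_le_sq_iff_one_le_abs]; nlinarith
      obtain ⟨x, hx, hx'⟩ := hq ((s + s⁻¹) / 2) ((v s).re)⁻¹ (by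
        rw [abs_inv]; exact inv_le_one_of_one_le₀ hvabs) (by
        rw [Complex.ofReal_inv, ← hvr, hw, inv_inv])
      exact hJs s h0 hs x hx hx'
  set c : ℂ → ℂ := fun s => Complex.exp (Complex.log (1 - v s ^ 2) / 2) with hc
  have hcsq : ∀ s : ℂ, ‖s‖ < 1 → c s ^ 2 = 1 - v s ^ 2 := by
    intro s hs
    simp only [hc]
    rw [← Complex.exp_nat_mul, show ((2 : ℕ) : ℂ) * (Complex.log (1 - v s ^ 2) / 2) = Complex.log (1 - v s ^ 2) by push_cast; ring]
    exact Complex.exp_log (Complex.slitPlane_ne_zero (hslit s hs))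
  have hcre : ∀ s : ℂ, ‖s‖ < 1 → 0 < (c s).re := by
    intro s hs
    simp only [hc]
    rw [Complex.exp_re]
    refine mul_pos (Real.exp_pos _) (Real.cos_pos_of_mem_Ioo ?_)
    have h1 := Complex.neg_pi_lt_arg (1 - v s ^ 2)
    have h2 : Complex.arg (1 - v s ^ 2) < Real.pi := lt_of_le_of_ne (Complex.arg_le_pi _) (Complex.mem_slitPlane_iff_arg.1 (hslit s hs)).1
    have h3 : (Complex.log (1 - v s ^ 2) / 2).im = Complex.arg (1 - v s ^ 2) / 2 := by
      rw [show (2:ℂ) = ((2:ℝ):ℂ) by norm_num, Complex.div_ofReal_im, Complex.log_im]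
    rw [h3]; constructor <;> linarith
  have hc1 : ∀ s : ℂ, ‖s‖ < 1 → 1 + c s ≠ 0 := by
    intro s hs h
    have := congrArg Complex.re h
    have h2 := hcre s hs
    simp at this; linarith
  set k : ℂ → ℂ := fun s => 1 / (T s * (1 + c s)) with hk
  have hkd : DifferentiableOn ℂ k (Metric.ball 0 1) := by
    intro s hs
    have hs' : ‖s‖ < 1 := by simpa using hs
    apply DifferentiableAt.differentiableWithinAt
    have hvd : DifferentiableAt ℂ v s := by
      simp only [hv]
      exact (differentiableAt_id.pow d).div (hTd s) (hTne s hs')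
    have hcd : DifferentiableAt ℂ c s := by
      simp only [hc]
      refine DifferentiableAt.cexp (DifferentiableAt.div_const ?_ _)
      exact DifferentiableAt.clog ((differentiableAt_const _).sub (hvd.pow 2)) (hslit s hs')
    simp only [hk]
    exact (differentiableAt_const _).div ((hTd s).mul ((differentiableAt_const _).add hcd)) (mul_ne_zero (hTne s hs') (hc1 s hs'))
  have hκ : ∀ s : ℂ, ‖s‖ < 1 → ‖v s / (1 + c s)‖ ≤ 1 := by
    intro s hs
    rw [norm_div]
    refine div_le_one_of_le₀ ?_ (norm_nonneg _)
    have h1 : v s ^ 2 = (1 - c s) * (1 + c s) := by linear_combination hcsq s hs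
    have h2 : ‖v s‖ ^ 2 = ‖1 - c s‖ * ‖1 + c s‖ := by rw [← norm_pow, h1, norm_mul]
    have h3 : ‖1 - c s‖ ≤ ‖1 + c s‖ := by
      rw [← sq_le_sq₀ (norm_nonneg _) (norm_nonneg _), ← Complex.normSq_eq_norm_sq, ← Complex.normSq_eq_norm_sq, Complex.normSq_apply, Complex.normSq_apply]
      have := hcre s hs
      simp
      nlinarith
    rw [← sq_le_sq₀ (norm_nonneg _) (norm_nonneg _), h2, pow_two]
    exact mul_le_mul_of_nonneg_right h3 (norm_nonneg _)
  have hκk : ∀ s : ℂ, v s / (1 + c s) = s ^ d * k s := by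
    intro s; simp only [hk, hv]; rw [div_div, mul_one_div]
  have hkle : ∀ r : ℝ, ‖s‖ < r → r < 1 → ‖k s‖ ≤ (r ^ d)⁻¹ := by
    intro r hr hr1
    have hr0 : 0 < r := (norm_nonneg s).trans_lt hr
    refine Complex.norm_le_of_forall_mem_frontier_norm_le (U := Metric.ball 0 r) Metric.isBounded_ball ?_ ?_ (subset_closure (by simpa using hr))
    · refine DifferentiableOn.diffContOnCl (hkd.mono ?_)
      rw [closure_ball _ hr0.ne']
      exact Metric.closedBall_subset_ball hr1
    · intro z hz
      rw [frontier_ball _ hr0.ne'] at hz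
      have hz' : ‖z‖ = r := by simpa using hz
      have := hκ z (by linarith)
      rw [hκk, norm_mul, norm_pow, hz'] at this
      rw [← one_div, le_div_iff₀ (pow_pos hr0 d), mul_comm]
      exact this
  have hk1 : ‖k s‖ ≤ 1 := by
    have ht : Filter.Tendsto (fun r : ℝ => (r ^ d)⁻¹) (nhdsWithin 1 (Set.Iio 1)) (nhds 1) := by
      have : ContinuousAt (fun r : ℝ => (r ^ d)⁻¹) 1 := by
        apply ContinuousAt.inv₀ (by fun_prop) (by simp)
      have h := this.tendsto
      simp only [one_pow, inv_one] at h
      exact h.mono_left nhdsWithin_le_nhds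
    refine ge_of_tendsto ht ?_
    filter_upwards [Ioo_mem_nhdsLT hs1] with r hr
    exact hkle r hr.1 hr.2
  have hvs : v s ≠ 0 := div_ne_zero (pow_ne_zero _ hs0) (hTne s hs1)
  refine ⟨v s / (1 + c s), div_ne_zero hvs (hc1 s hs1), ?_, ?_⟩
  · rw [hκk, norm_mul, norm_pow]
    exact mul_le_of_le_one_right (by positivity) hk1
  · have hw : q.eval ((s + s⁻¹) / 2) = (v s)⁻¹ := by
      simp only [hv]; rw [hTe s hs0]
      have := pow_ne_zero d hs0
      field_simp
    rw [hw]
    have h1 := hc1 s hs1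
    have h2 := hcsq s hs1
    field_simp
    linear_combination -h2

theorem deriv_bound (q : Polynomial ℝ) (d : ℕ) (hd : 1 ≤ d) (hdeg : q.natDegree = d)
    (hq : ∀ z : ℂ, ∀ t : ℝ, |t| ≤ 1 → (q.map (algebraMap ℝ ℂ)).eval z = t → ∃ x : ℝ, |x| ≤ 1 ∧ z = x)
    (x : ℝ) (hx : |x| < 1) (hfix : q.eval x = x) : (d : ℝ) ≤ |q.derivative.eval x| := by
  set Q := q.map (algebraMap ℝ ℂ) with hQ
  set θ := Real.arccos x
  have hx' := abs_lt.1 hx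
  have hcos : Real.cos θ = x := Real.cos_arccos hx'.1.le hx'.2.le
  set w : ℝ → ℂ := fun τ => Q.eval (Complex.cos (θ + τ * Complex.I)) with hw
  have hQx : ∀ (r : Polynomial ℝ), (r.map (algebraMap ℝ ℂ)).eval (x : ℂ) = ((r.eval x : ℝ) : ℂ) := by
    intro r
    exact Polynomial.eval_map_algebraMap r (x:ℂ) |>.trans (Polynomial.aeval_ofReal r x)
  have hw0 : w 0 = x := by
    simp only [hw]
    rw [Complex.ofReal_zero, zero_mul, add_zero, ← Complex.ofReal_cos, hcos, hQ, hQx, hfix]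
  have hwd : HasDerivAt w (((- q.derivative.eval x * Real.sin θ : ℝ) : ℂ) * Complex.I) 0 := by
    have h1 : HasDerivAt (fun z : ℂ => Q.eval (Complex.cos (θ + z * Complex.I)))
        (Q.derivative.eval (Complex.cos (θ + (0:ℝ) * Complex.I)) * (-Complex.sin (θ + (0:ℝ) * Complex.I) * (1 * Complex.I))) ((0:ℝ) : ℂ) := by
      have h2 : HasDerivAt (fun z : ℂ => (θ:ℂ) + z * Complex.I) (1 * Complex.I) ((0:ℝ) : ℂ) :=
        ((hasDerivAt_id _).mul_const _).const_add _
      exact (Q.hasDerivAt _).comp _ h2.ccos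
    have h3 := h1.comp_ofReal
    convert h3 using 1
    rw [Complex.ofReal_zero, zero_mul, add_zero, ← Complex.ofReal_cos, ← Complex.ofReal_sin, hcos, hQ, Polynomial.derivative_map, hQx]
    push_cast; ring
  set β := - q.derivative.eval x * Real.sin θ with hβ
  have him : HasDerivAt (fun τ => (w τ).im) β 0 := by
    have := Complex.imCLM.hasFDerivAt.comp_hasDerivAt (0:ℝ) hwd
    have e : Complex.imCLM ((β : ℂ) * Complex.I) = β := by simp
    rw [e] at this
    exact this
  have hre : Filter.Tendsto (fun τ => (w τ).re) (nhdsWithin 0 (Set.Ioi 0)) (nhds x) := by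
    have := (Complex.continuous_re.continuousAt.comp hwd.continuousAt).tendsto
    simp only [Function.comp_apply, hw0, Complex.ofReal_re] at this
    exact this.mono_left nhdsWithin_le_nhds
  have him' : Filter.Tendsto (fun τ => (w τ).im / τ) (nhdsWithin 0 (Set.Ioi 0)) (nhds β) := by
    have := him.tendsto_slope_zero_right
    simpa [hw0, div_eq_inv_mul] using this
  have hsinh : Filter.Tendsto (fun τ : ℝ => Real.sinh (d * τ) / τ) (nhdsWithin 0 (Set.Ioi 0)) (nhds d) := by
    have h : HasDerivAt (fun τ : ℝ => Real.sinh (d * τ)) d 0 := by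
      have := ((hasDerivAt_id (0:ℝ)).const_mul (d:ℝ)).sinh
      simpa using this
    have := h.tendsto_slope_zero_right
    simpa [div_eq_inv_mul] using this
  have hcosh : Filter.Tendsto (fun τ : ℝ => Real.cosh (d * τ)) (nhdsWithin 0 (Set.Ioi 0)) (nhds 1) := by
    have h : ContinuousAt (fun τ : ℝ => Real.cosh (d * τ)) 0 := by fun_prop
    have := h.tendsto
    simp only [mul_zero, Real.cosh_zero] at this
    exact this.mono_left nhdsWithin_le_nhds
  have hlim := le_of_tendsto_of_tendsto ((hsinh.pow 2).mul (hcosh.pow 2))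
    (((hre.pow 2).mul (hsinh.pow 2)).add ((him'.pow 2).mul (hcosh.pow 2))) (by
      filter_upwards [self_mem_nhdsWithin] with τ hτ
      have hτ : 0 < τ := hτ
      set s : ℂ := Complex.exp ((θ + τ * Complex.I) * Complex.I) with hs
      have hsn : ‖s‖ = Real.exp (-τ) := by
        rw [hs, Complex.norm_exp]; congr 1; simp
      obtain ⟨κ, hκ0, hκ1, hκ2⟩ := key_bound Q d hd (by rw [hQ, Polynomial.natDegree_map, hdeg]) hq s (Complex.exp_ne_zero _) (by rw [hsn]; simpa using hτ)
      have hwe : w τ = (κ + κ⁻¹) / 2 := by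
        rw [← hκ2]; simp only [hw]
        rw [Complex.cos, hs, ← Complex.exp_neg, neg_mul]
      have hdτ : 0 < (d:ℝ) * τ := by
        have : (0:ℝ) < d := by exact_mod_cast hd
        positivity
      have := ellipse_bound κ hκ0 (d * τ) hdτ (by
        rw [hsn, ← Real.exp_nat_mul] at hκ1
        convert hκ1 using 2; ring) (w τ) hwe
      simp only [div_pow]
      rw [← sub_nonneg] at this ⊢
      convert div_nonneg this (sq_nonneg τ) using 1
      field_simp)
  have hsin : Real.sin θ ^ 2 = 1 - x ^ 2 := by
    rw [← hcos]; linarith [Real.sin_sq_add_cos_sq θ]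
  have hpos : 0 < 1 - x ^ 2 := by
    have := (sq_lt_one_iff_abs_lt_one x).2 hx; linarith
  rw [hβ, mul_pow, hsin] at hlim
  have : (d:ℝ) ^ 2 ≤ (q.derivative.eval x) ^ 2 := by
    refine le_of_mul_le_mul_right ?_ hpos
    nlinarith
  exact le_of_abs_le (sq_le_sq.1 this) 

theorem stmt_13_aux (p : Polynomial ℝ) (d : ℕ) (hd : 1 < d) (hdeg : p.natDegree = d) (a b : ℝ) 
    (hab : ∀ z : ℂ, ((p.map (algebraMap ℝ ℂ)).eval z = a ∨ (p.map (algebraMap ℝ ℂ)).eval z = b) → ∃ x : ℝ, a ≤ x ∧ x ≤ b ∧ z = x)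
    (z : ℂ) (t : ℝ) (ht1 : a ≤ t) (ht2 : t ≤ b) (hz : (p.map (algebraMap ℝ ℂ)).eval z = t) :
    ∃ x : ℝ, a ≤ x ∧ x ≤ b ∧ z = x := by
  set P := p.map (algebraMap ℝ ℂ) with hP
  rcases ht1.eq_or_lt with h | ht1
  · exact hab z (Or.inl (by rw [hz, h]))
  rcases ht2.eq_or_lt with h | ht2
  · exact hab z (Or.inr (by rw [hz, h]))
  by_contra hcon
  have hc : ∃ c : ℂ, ∀ r : ℝ, a ≤ r → r ≤ b → 0 < (c * (1 / (z - r))).re := by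
    have hne : ∀ r : ℝ, a ≤ r → r ≤ b → 0 < Complex.normSq (z - r) := by
      intro r h1 h2
      rw [Complex.normSq_pos]
      intro h; exact hcon ⟨r, h1, h2, by linear_combination h⟩
    rcases lt_trichotomy z.im 0 with h | h | h
    · refine ⟨-Complex.I, fun r h1 h2 => ?_⟩
      have := hne r h1 h2
      simp [Complex.inv_im]
      exact div_pos (by linarith) this
    · rcases lt_or_ge z.re a with h3 | h3
      · refine ⟨-1, fun r h1 h2 => ?_⟩
        have := hne r h1 h2
        simp [Complex.inv_re]
        exact div_neg_of_neg_of_pos (by linarith) this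
      · have h4 : b < z.re := by
          by_contra h4
          exact hcon ⟨z.re, h3, not_lt.1 h4, Complex.ext (by simp) (by simp [h])⟩
        refine ⟨1, fun r h1 h2 => ?_⟩
        have := hne r h1 h2
        simp [Complex.inv_re]
        exact div_pos (by linarith) this
    · refine ⟨Complex.I, fun r h1 h2 => ?_⟩
      have := hne r h1 h2
      simp [Complex.inv_im]
      exact div_neg_of_neg_of_pos (by linarith) this
  obtain ⟨c, hc⟩ := hc
  have main : ∀ e : ℝ, (e = a ∨ e = b) → 0 < (c * (P.derivative.eval z / (t - e))).re := by
    intro e he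
    have hte : (t:ℂ) - e ≠ 0 := by
      rw [← Complex.ofReal_sub, Complex.ofReal_ne_zero]
      rcases he with rfl | rfl <;> intro h <;> linarith
    have hPe : (P - C (e:ℂ)).eval z = t - e := by simp [hz]
    have h1 := (IsAlgClosed.splits (P - C (e:ℂ))).eval_derivative_div_eval_of_ne_zero (x := z) (by rw [hPe]; exact hte)
    rw [hPe] at h1
    have h2 : (P - C (e:ℂ)).derivative = P.derivative := by simp
    rw [h2] at h1
    rw [h1]
    have hroots : ∀ r ∈ (P - C (e:ℂ)).roots, 0 < (c * (1 / (z - r))).re := by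
      intro r hr
      have := Polynomial.isRoot_of_mem_roots hr
      have h3 : P.eval r = e := by
        simpa [sub_eq_zero] using this
      obtain ⟨x, hx1, hx2, rfl⟩ := hab r (by rcases he with rfl | rfl <;> simp [h3])
      exact hc x hx1 hx2
    have hcard : (P - C (e:ℂ)).roots.card = d := by
      rw [← (IsAlgClosed.splits (P - C (e:ℂ))).natDegree_eq_card_roots, Polynomial.natDegree_sub_C, hP, Polynomial.natDegree_map, hdeg]
    generalize (P - C (e:ℂ)).roots = m at hroots hcard
    have hm : m ≠ 0 := by rintro rfl; simp at hcard; omega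
    clear hcard h1
    induction m using Multiset.induction_on with
    | empty => exact absurd rfl hm
    | cons r m ih =>
      rw [Multiset.map_cons, Multiset.sum_cons, mul_add, Complex.add_re]
      have h0 := hroots r (by simp)
      by_cases hm' : m = 0
      · subst hm'; simpa using h0
      · have := ih (fun r hr => hroots r (by simp [hr])) hm'
        linarith
  have ma := main a (Or.inl rfl)
  have mb := main b (Or.inr rfl)
  rw [← mul_div_assoc, ← Complex.ofReal_sub, Complex.div_ofReal_re] at ma mb
  rw [div_pos_iff] at ma mb
  rcases ma with ma | ma <;> rcases mb with mb | mb <;> linarith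

theorem filled_facts (P : Polynomial ℂ) (hdeg : 1 < P.natDegree) :
    IsClosed (filledJuliaSet P) ∧ Bornology.IsBounded (filledJuliaSet P) := by
  have ho := Polynomial.isLittleO_cobounded_of_degree_lt (P := (X : Polynomial ℂ)) (Q := P) (by
    rw [Polynomial.degree_X]
    rw [Polynomial.degree_eq_natDegree (by rintro rfl; simp at hdeg)]
    exact_mod_cast hdeg)
  have hev := ho.bound (c := 1 / 2) (by norm_num)
  rw [← comap_norm_atTop, Filter.eventually_comap, Filter.eventually_atTop] at hev
  obtain ⟨R0, hR0⟩ := hev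
  set R := max R0 1 with hR
  have hesc : ∀ z : ℂ, R ≤ ‖z‖ → 2 * ‖z‖ ≤ ‖P.eval z‖ := by
    intro z hz
    have := hR0 ‖z‖ (le_trans (le_max_left _ _) hz) z rfl
    simp at this
    linarith
  have hR1 : 1 ≤ R := le_max_right _ _
  have hgrow : ∀ (n : ℕ) (z : ℂ), R ≤ ‖z‖ → 2 ^ n * ‖z‖ ≤ ‖(fun w => P.eval w)^[n] z‖ := by
    intro n
    induction n with
    | zero => intro z hz; simp
    | succ n ih =>
      intro z hz
      have h1 := hesc z hz
      have h2 := ih (P.eval z) (by linarith [norm_nonneg z])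
      rw [Function.iterate_succ_apply]
      refine le_trans ?_ h2
      rw [pow_succ, mul_assoc]
      gcongr
  have hbd : ∀ z ∈ filledJuliaSet P, ‖z‖ ≤ R := by
    intro z hz
    by_contra hcon
    have hcon : R < ‖z‖ := not_le.1 hcon
    have hz : Bornology.IsBounded (Set.range fun n => (fun w => P.eval w)^[n] z) := hz
    obtain ⟨M, hM⟩ := hz.exists_norm_le
    obtain ⟨n, hn⟩ := pow_unbounded_of_one_lt M (one_lt_two)
    have h1 := hM _ ⟨n, rfl⟩
    have h2 := hgrow n z hcon.le
    have h3 : (2:ℝ) ^ n * 1 ≤ 2 ^ n * ‖z‖ := by gcongr; linarith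
    simp only at h1
    linarith
  have hiter : ∀ z ∈ filledJuliaSet P, ∀ n, (fun w => P.eval w)^[n] z ∈ filledJuliaSet P := by
    intro z hz n
    have hz : Bornology.IsBounded (Set.range fun n => (fun w => P.eval w)^[n] z) := hz
    refine Bornology.IsBounded.subset hz ?_
    rintro _ ⟨m, rfl⟩
    exact ⟨m + n, by simp only [Function.iterate_add_apply]⟩
  have heq : filledJuliaSet P = ⋂ n : ℕ, {z | ‖(fun w => P.eval w)^[n] z‖ ≤ R} := by
    ext z
    simp only [Set.mem_iInter, Set.mem_ofPred_eq]
    constructor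
    · intro hz n; exact hbd _ (hiter z hz n)
    · intro h
      refine (Metric.isBounded_closedBall (x := (0:ℂ)) (r := R)).subset ?_
      rintro _ ⟨n, rfl⟩
      simpa using h n
  refine ⟨?_, (Metric.isBounded_closedBall (x := (0:ℂ)) (r := R)).subset fun z hz => by simpa using hbd z hz⟩
  rw [heq]
  refine isClosed_iInter fun n => isClosed_le ?_ continuous_const
  exact (P.continuous.iterate n).norm

theorem halfplane_false (K U : Set ℂ) (hU : IsPreconnected U) (hub : ¬ Bornology.IsBounded U)
    (hKb : Bornology.IsBounded K) (hUf : ∀ z ∈ U, z ∉ frontier K) (z : ℂ) (hzU : z ∈ U) : z ∉ K := by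
  intro hz
  have hmem : ∀ y ∈ U, y ∈ interior K ∨ y ∈ (closure K)ᶜ := by
    intro y hy
    by_contra hcon
    push Not at hcon
    exact hUf y hy ⟨not_not.1 hcon.2, hcon.1⟩
  have hzi : z ∈ interior K := by
    rcases hmem z hzU with h | h
    · exact h
    · exact absurd (subset_closure hz) h
  have : ∃ y ∈ U, y ∉ K := by
    by_contra hcon
    push Not at hcon
    exact hub (hKb.subset hcon)
  obtain ⟨y, hyU, hyK⟩ := this
  have hy : y ∈ (closure K)ᶜ := by
    rcases hmem y hyU with h | h
    · exact absurd (interior_subset h) hyK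
    · exact h
  obtain ⟨x, _, hx1, hx2⟩ := hU (interior K) (closure K)ᶜ isOpen_interior isClosed_closure.isOpen_compl
    hmem ⟨z, hzU, hzi⟩ ⟨y, hyU, hy⟩
  exact hx2 (subset_closure (interior_subset hx1))

theorem filled_real (K : Set ℂ) (hKb : Bornology.IsBounded K) (hf : ∀ z ∈ frontier K, z.im = 0)
    (z : ℂ) (hz : z ∈ K) : z.im = 0 := by
  have hub : ∀ (ε : ℝ), ε ≠ 0 → ∀ U : Set ℂ, (∀ t : ℝ, 0 < t → (⟨0, ε * t⟩ : ℂ) ∈ U) → ¬ Bornology.IsBounded U := by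
    intro ε hε U hU hb
    obtain ⟨M, hM⟩ := hb.exists_norm_le
    have h := hM _ (hU ((|M| + 1) / |ε|) (by positivity))
    have h2 := (Complex.abs_im_le_norm _).trans h
    simp only [abs_mul, abs_div, abs_abs] at h2
    have : |ε| ≠ 0 := by simpa using hε
    field_simp at h2
    have h3 : |(|M| + 1)| = |M| + 1 := abs_of_pos (by positivity)
    rw [h3] at h2
    linarith [le_abs_self M]
  rcases lt_trichotomy z.im 0 with h | h | h
  · refine absurd hz (halfplane_false K {z | z.im < 0} (convex_halfSpace_im_lt 0).isPreconnected
      (hub (-1) (by norm_num) _ (by intro t ht; simpa using ht)) hKb ?_ z h)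
    intro y hy hyf
    have hy : y.im < 0 := hy
    linarith [hf y hyf]
  · exact h
  · refine absurd hz (halfplane_false K {z | 0 < z.im} (convex_halfSpace_im_gt 0).isPreconnected
      (hub 1 (by norm_num) _ (by intro t ht; simpa using ht)) hKb ?_ z h)
    intro y hy hyf
    have hy : 0 < y.im := hy
    linarith [hf y hyf]

end Helpers

open Polynomial (C X)

/-- Interior fixed points of a real polynomial with real Julia set have multiplier
at least `d` in absolute value. -/
theorem stmt_13 (p : Polynomial ℝ) (d : ℕ) (hd : 1 < d) (hdeg : p.natDegree = d)
    (hJ : ∀ z ∈ juliaSet (p.map (algebraMap ℝ ℂ)), z.im = 0)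
    (a b : ℝ)
    (ha : IsLeast {x : ℝ | (x : ℂ) ∈ juliaSet (p.map (algebraMap ℝ ℂ))} a)
    (hb : IsGreatest {x : ℝ | (x : ℂ) ∈ juliaSet (p.map (algebraMap ℝ ℂ))} b)
    (ξ : ℝ) (hfix : p.eval ξ = ξ) (h1 : a < ξ) (h2 : ξ < b) :
    (d : ℝ) ≤ |(Polynomial.derivative p).eval ξ| := by
  set P := p.map (algebraMap ℝ ℂ) with hP
  have hPd : P.natDegree = d := by rw [hP, Polynomial.natDegree_map, hdeg]
  obtain ⟨hcl, hbd⟩ := filled_facts P (by omega)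
  have hreal : ∀ z ∈ filledJuliaSet P, z.im = 0 := filled_real _ hbd hJ
  have hKJ : ∀ z ∈ filledJuliaSet P, z ∈ juliaSet P := by
    intro z hz
    refine ⟨subset_closure hz, fun hi => ?_⟩
    obtain ⟨ε, hε, hball⟩ := Metric.mem_nhds_iff.1 (mem_interior_iff_mem_nhds.1 hi)
    have h1 := hreal z hz
    have h2 := hreal (z + ((ε / 2 : ℝ) : ℂ) * Complex.I) (hball (by
      rw [Metric.mem_ball, dist_eq_norm]
      rw [add_sub_cancel_left, norm_mul, Complex.norm_I, mul_one, Complex.norm_real, Real.norm_eq_abs, abs_of_pos (by positivity)]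
      linarith))
    rw [Complex.add_im, h1, Complex.im_ofReal_mul, Complex.I_im] at h2
    linarith
  have hJK : ∀ z ∈ juliaSet P, z ∈ filledJuliaSet P := fun z hz => hcl.frontier_subset hz
  have hpre : ∀ z, P.eval z ∈ filledJuliaSet P → z ∈ filledJuliaSet P := by
    intro z hz
    refine Bornology.IsBounded.subset (Bornology.IsBounded.union (s := {z}) Bornology.isBounded_singleton hz) ?_
    rintro _ ⟨n, rfl⟩
    cases n with
    | zero => left; simp
    | succ n => right; exact ⟨n, by simp only [Function.iterate_succ_apply]⟩
  have hab : ∀ z : ℂ, (P.eval z = a ∨ P.eval z = b) → ∃ x : ℝ, a ≤ x ∧ x ≤ b ∧ z = x := by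
    intro z hz
    have hzK : z ∈ filledJuliaSet P := by
      apply hpre
      rcases hz with h | h <;> rw [h]
      · exact hJK _ ha.1
      · exact hJK _ hb.1
    have hzr : z = (z.re : ℂ) := Complex.ext (by simp) (by simpa using hreal z hzK)
    have hzJ := hKJ z hzK
    rw [hzr] at hzJ
    exact ⟨z.re, ha.2 hzJ, hb.2 hzJ, hzr⟩
  have hinv := stmt_13_aux p d hd hdeg a b hab
  set m := (a + b) / 2 with hm
  set h := (b - a) / 2 with hh
  have hpos : 0 < h := by rw [hh]; linarith
  set q : Polynomial ℝ := C h⁻¹ * (p.comp (C h * X + C m) - C m) with hq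
  have hqe : ∀ x, q.eval x = h⁻¹ * (p.eval (h * x + m) - m) := by
    intro x; simp [hq]
  have hqe' : ∀ z : ℂ, (q.map (algebraMap ℝ ℂ)).eval z = (h : ℂ)⁻¹ * (P.eval (h * z + m) - m) := by
    intro z; simp [hq, hP, Polynomial.map_comp]
  have hqd : q.natDegree = d := by
    rw [hq, Polynomial.natDegree_C_mul (inv_ne_zero hpos.ne'), Polynomial.natDegree_sub_C, Polynomial.natDegree_comp,
      Polynomial.natDegree_linear hpos.ne', hdeg, mul_one]
  have hhC : (h : ℂ) ≠ 0 := by exact_mod_cast hpos.ne'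
  have key := deriv_bound q d hd.le hqd (by
    intro z t ht hz
    rw [hqe'] at hz
    have ht := abs_le.1 ht
    obtain ⟨x, hx1, hx2, hx3⟩ := hinv (h * z + m) (h * t + m) (by nlinarith) (by nlinarith) (by
      field_simp at hz
      push_cast
      linear_combination hz)
    refine ⟨(x - m) / h, ?_, ?_⟩
    · rw [abs_le, le_div_iff₀ hpos, div_le_iff₀ hpos]
      constructor <;> linarith
    · push_cast
      field_simp
      linear_combination hx3) ((ξ - m) / h) (by
    rw [abs_lt, lt_div_iff₀ hpos, div_lt_iff₀ hpos]
    constructor <;> linarith) (by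
    rw [hqe, mul_div_cancel₀ _ hpos.ne', sub_add_cancel, hfix]; field_simp)
  have hder : q.derivative.eval ((ξ - m) / h) = p.derivative.eval ξ := by
    simp [hq, Polynomial.derivative_comp]
    rw [mul_div_cancel₀ _ hpos.ne', sub_add_cancel]
    field_simp
  rwa [hder] at key
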